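/- Let Ω ⊂ ℝ^N (N ≥ 2) be a bounded open nonempty set with |Ω| = 1, let p > 1 and λ ≥ 0, and let (α, ψ) be a classical solution of (P)_λ on Ω with α ≥ 0. Then α ≤ 1, and α = 1 if and only if λ = 0. -/

import Mathlib

open MeasureTheory Real Set

noncomputable section

/-- The Euclidean Laplacian of `f : ℝ^N → ℝ` at a point `x`, defined as the sum of the
second partial derivatives in the coordinate directions. -/
noncomputable def lap {N : ℕ} (f : EuclideanSpace ℝ (Fin N) → ℝ)
    (x : EuclideanSpace ℝ (Fin N)) : ℝ :=
  ∑ i : Fin N,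
    fderiv ℝ (fun y => fderiv ℝ f y (EuclideanSpace.single i 1)) x (EuclideanSpace.single i 1)

/-- `(α, ψ)` is a classical solution of problem `(P)_λ` on `Ω`. -/
def IsSolP {N : ℕ} (Ω : Set (EuclideanSpace ℝ (Fin N))) (p lam α : ℝ)
    (ψ : EuclideanSpace ℝ (Fin N) → ℝ) : Prop :=
  ContinuousOn ψ (closure Ω) ∧ ContDiffOn ℝ 2 ψ Ω ∧
  (∀ x ∈ Ω, 0 < ψ x) ∧ (∀ x ∈ frontier Ω, ψ x = 0) ∧
  (∀ x ∈ Ω, -lap ψ x = (α + lam * ψ x) ^ p) ∧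
  (∫ x in Ω, (α + lam * ψ x) ^ p) = 1

/-- If `|Ω| = 1`, `λ ≥ 0` and `(α, ψ)` is a classical solution of `(P)_λ` with `α ≥ 0`,
then necessarily `α ≤ 1`, and `α = 1` if and only if `λ = 0`. -/
theorem statement9 {N : ℕ} (hN : 2 ≤ N) (Ω : Set (EuclideanSpace ℝ (Fin N)))
    (hΩo : IsOpen Ω) (hΩb : Bornology.IsBounded Ω) (hΩne : Ω.Nonempty)
    (hvol : volume Ω = 1)
    (p lam α : ℝ) (hp : 1 < p) (hlam : 0 ≤ lam) (hα : 0 ≤ α)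
    (ψ : EuclideanSpace ℝ (Fin N) → ℝ) (hsol : IsSolP Ω p lam α ψ) :
    α ≤ 1 ∧ (α = 1 ↔ lam = 0) := by
  obtain ⟨hc, -, hpos, -, -, hint⟩ := hsol
  have hp0 : 0 < p := by linarith
  rcases hlam.eq_or_lt with rfl | hl
  · have hα1 : α ^ p = 1 := by simpa [Measure.real, hvol] using hint
    have : α = 1 := (Real.rpow_left_inj hα zero_le_one hp0.ne').1 (by rw [hα1, Real.one_rpow])
    exact ⟨this.le, by simp [this]⟩
  · suffices h : α < 1 from ⟨h.le, iff_of_false h.ne hl.ne'⟩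
    have hcont : ContinuousOn (fun x => (α + lam * ψ x) ^ p) (closure Ω) :=
      (continuousOn_const.add (continuousOn_const.mul hc)).rpow_const
        fun _ _ => Or.inr hp0.le
    have hi : IntegrableOn (fun x => (α + lam * ψ x) ^ p) Ω :=
      (hcont.integrableOn_compact hΩb.isCompact_closure).mono_set subset_closure
    by_contra! hα1
    have hgt : ∀ x ∈ Ω, 0 < (α + lam * ψ x) ^ p - 1 := fun x hx => by
      have := mul_pos hl (hpos x hx)
      exact sub_pos.2 (Real.one_lt_rpow (by linarith) hp0)
    have hconst : IntegrableOn (fun _ : EuclideanSpace ℝ (Fin N) => (1 : ℝ)) Ω :=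
      integrableOn_const (by simp [hvol])
    have hlt : 0 < ∫ x in Ω, ((α + lam * ψ x) ^ p - 1) := by
      rw [setIntegral_pos_iff_support_of_nonneg_ae
        ((ae_restrict_iff' hΩo.measurableSet).2 (.of_forall fun x hx => (hgt x hx).le))
        (hi.sub hconst),
        inter_eq_self_of_subset_right fun x hx => Function.mem_support.2 (hgt x hx).ne', hvol]
      exact one_pos
    rw [integral_sub hi hconst, hint] at hlt
    simp [Measure.real, hvol] at hlt

end
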